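/- Define F(x) = ∑_{n≥1} ∑_{m=0}^{n−1} 1/((n+1/2)(m+1/2)) · Γ(1/2+m−x)·Γ(1/2+n+x) / ( Γ(3/2+n−x)·Γ(3/2+m+x) ), which converges for Re(x) < 1/2. Then for all x ∈ ℂ with Re(x) < −3/2 and x ∉ ℤ + 1/2, the inhomogeneous second-order recurrence x³·F(x) − 2(x+1)³·F(x+1) + (x+2)³·F(x+2) + 4(2x² + 4x + 1)/((2x+1)²(2x+3)²) = 0 holds. -/

import Mathlib

/-- The generating function
`F(x) = ∑_{n≥1} ∑_{m=0}^{n−1} 1/((n+1/2)(m+1/2)) · Γ(1/2+m−x) Γ(1/2+n+x) /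
(Γ(3/2+n−x) Γ(3/2+m+x))` of the interpolated multiple t values `t^{1/2}(2,{1}^k,2)`
(the `n = 0` term of the outer sum is an empty sum, so it contributes `0`). -/
noncomputable def Fgen (x : ℂ) : ℂ :=
  ∑' n : ℕ, ∑ m ∈ Finset.range n,
    1 / (((n : ℂ) + 1/2) * ((m : ℂ) + 1/2)) *
      (Complex.Gamma (1/2 + (m : ℂ) - x) * Complex.Gamma (1/2 + (n : ℂ) + x)) /
      (Complex.Gamma (3/2 + (n : ℂ) - x) * Complex.Gamma (3/2 + (m : ℂ) + x))

open Filter Topology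

/-- Non-half-integrality. -/
def HH (x : ℂ) : Prop := ∀ k : ℤ, x ≠ (k : ℂ) + 1/2

/-- The Gamma quotient. -/
noncomputable def uu (x : ℂ) (n : ℕ) : ℂ :=
  Complex.Gamma (1/2 + (n : ℂ) + x) / Complex.Gamma (3/2 + (n : ℂ) - x)

lemma HH.neg {x : ℂ} (h : HH x) : HH (-x) := by
  intro k hk
  apply h (-k - 1)
  push_cast
  linear_combination -hk

lemma HH.add_one {x : ℂ} (h : HH x) : HH (x + 1) := by
  intro k hk
  apply h (k - 1)
  push_cast
  linear_combination hk

lemma HH.ne {x : ℂ} (h : HH x) (k : ℤ) : (k : ℂ) + 1/2 + x ≠ 0 := by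
  intro hk
  apply h (-k - 1)
  push_cast
  linear_combination hk

lemma ratio_bound (a b : ℂ) (ha : ∀ k : ℤ, a ≠ k) (hb : ∀ k : ℤ, b ≠ k) :
    ∃ C : ℝ, 0 ≤ C ∧ ∀ n : ℕ, ‖Complex.Gamma (a + n) / Complex.Gamma (b + n)‖
      ≤ C * ((n : ℝ) + 1) ^ (a - b).re := by
  have key : ∀ s : ℂ, (∀ k : ℤ, s ≠ k) → Complex.Gamma (s - 1) ≠ 0 ∧
      ∀ n : ℕ, Complex.Gamma (s + n) * Complex.GammaSeq (s - 1) n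
        = Complex.Gamma (s - 1) * ((n : ℂ) ^ (s - 1) * (n.factorial : ℂ)) := by
    intro s hs
    have hne : ∀ j : ℕ, s - 1 + j ≠ 0 := by
      intro j hj
      apply hs (1 - j)
      push_cast
      linear_combination hj
    refine ⟨Complex.Gamma_ne_zero (fun m hm => hne m (by rw [hm]; ring)), fun n => ?_⟩
    have hprod : ∀ n : ℕ, Complex.Gamma (s + n)
        = Complex.Gamma (s - 1) * ∏ j ∈ Finset.range (n + 1), (s - 1 + j) := by
      intro n
      induction n with
      | zero =>
        have := Complex.Gamma_add_one (s - 1) (by simpa using hne 0)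
        simp only [sub_add_cancel] at this
        simp [this, mul_comm]
      | succ n ih =>
        rw [Finset.prod_range_succ, ← mul_assoc, ← ih]
        have h1 : s + (n : ℂ) ≠ 0 := by
          have := hne (n + 1)
          push_cast at this
          intro h
          apply this
          linear_combination h
        have := Complex.Gamma_add_one (s + n) h1
        push_cast
        rw [← add_assoc, this]
        ring
    have hp : ∏ j ∈ Finset.range (n + 1), (s - 1 + j) ≠ 0 :=
      Finset.prod_ne_zero_iff.mpr (fun j _ => hne j)
    rw [hprod, Complex.GammaSeq]
    field_simp
  obtain ⟨ha0, haS⟩ := key a ha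
  obtain ⟨hb0, hbS⟩ := key b hb
  have hta := Complex.GammaSeq_tendsto_Gamma (a - 1)
  have htb := Complex.GammaSeq_tendsto_Gamma (b - 1)
  have hlim : Tendsto (fun n : ℕ => ‖Complex.Gamma (a - 1) / Complex.Gamma (b - 1) *
      (Complex.GammaSeq (b - 1) n / Complex.GammaSeq (a - 1) n)‖ *
      ((n : ℝ) / ((n : ℝ) + 1)) ^ (a - b).re) atTop
      (𝓝 (‖Complex.Gamma (a - 1) / Complex.Gamma (b - 1) *
      (Complex.Gamma (b - 1) / Complex.Gamma (a - 1))‖ * (1 : ℝ) ^ (a - b).re)) := by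
    refine Tendsto.mul (((htb.div hta ha0).const_mul _).norm) ?_
    refine Tendsto.rpow_const ?_ (Or.inl one_ne_zero)
    exact tendsto_natCast_div_add_atTop (1 : ℝ)
  have hlim2 : Tendsto (fun n : ℕ => ‖Complex.Gamma (a + n) / Complex.Gamma (b + n)‖ /
      ((n : ℝ) + 1) ^ (a - b).re) atTop
      (𝓝 (‖Complex.Gamma (a - 1) / Complex.Gamma (b - 1) *
      (Complex.Gamma (b - 1) / Complex.Gamma (a - 1))‖ * (1 : ℝ) ^ (a - b).re)) := by
    refine hlim.congr' ?_
    filter_upwards [eventually_gt_atTop 0, hta.eventually_ne ha0, htb.eventually_ne hb0]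
      with n hn hna hnb
    have hn' : (n : ℂ) ≠ 0 := by exact_mod_cast hn.ne'
    have hnR : (0 : ℝ) < n := by exact_mod_cast hn
    have e1 : Complex.Gamma (a + n) = Complex.Gamma (a - 1) * ((n : ℂ) ^ (a - 1) * (n.factorial : ℂ))
        / Complex.GammaSeq (a - 1) n := by
      rw [eq_div_iff hna, haS]
    have e2 : Complex.Gamma (b + n) = Complex.Gamma (b - 1) * ((n : ℂ) ^ (b - 1) * (n.factorial : ℂ))
        / Complex.GammaSeq (b - 1) n := by
      rw [eq_div_iff hnb, hbS]
    have e3 : (n : ℂ) ^ (a - 1) = (n : ℂ) ^ (b - 1) * (n : ℂ) ^ (a - b) := by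
      rw [← Complex.cpow_add _ _ hn']
      congr 1
      ring
    have hf : (n.factorial : ℂ) ≠ 0 := by exact_mod_cast n.factorial_ne_zero
    have hc : (n : ℂ) ^ (b - 1) ≠ 0 := by simp [Complex.cpow_eq_zero_iff, hn']
    have e4 : Complex.Gamma (a + n) / Complex.Gamma (b + n) =
        Complex.Gamma (a - 1) / Complex.Gamma (b - 1) *
      (Complex.GammaSeq (b - 1) n / Complex.GammaSeq (a - 1) n) * (n : ℂ) ^ (a - b) := by
      rw [e1, e2, e3]
      field_simp
    rw [e4, norm_mul _ ((n : ℂ) ^ (a - b)), Complex.norm_natCast_cpow_of_pos hn,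
      Real.div_rpow hnR.le (by positivity), mul_div_assoc]
  obtain ⟨C, hC⟩ := hlim2.bddAbove_range
  refine ⟨max C 0, le_max_right _ _, fun n => ?_⟩
  have h1 := hC (Set.mem_range_self n)
  have hpos : (0 : ℝ) < ((n : ℝ) + 1) ^ (a - b).re := by positivity
  rw [← div_le_iff₀ hpos]
  exact h1.trans (le_max_left _ _)

lemma uu_bound (x : ℂ) (h : HH x) :
    ∃ C : ℝ, 0 ≤ C ∧ ∀ n : ℕ, ‖uu x n‖ ≤ C * ((n : ℝ) + 1) ^ (2 * x.re - 1) := by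
  obtain ⟨C, hC, hb⟩ := ratio_bound (1/2 + x) (3/2 - x)
    (fun k hk => h (k - 1) (by push_cast; linear_combination hk))
    (fun k hk => h (1 - k) (by push_cast; linear_combination -hk))
  refine ⟨C, hC, fun n => ?_⟩
  have := hb n
  have e : ((1/2 + x) - (3/2 - x)).re = 2 * x.re - 1 := by
    have : ((1/2 + x) - (3/2 - x)) = x + x - 1 := by ring
    rw [this]
    simp
    ring
  rw [e] at this
  unfold uu
  convert this using 4 <;> ring

lemma summable_shift {q : ℝ} (hq : q < -1) : Summable (fun n : ℕ => ((n : ℝ) + 1) ^ q) := by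
  have := (summable_nat_add_iff 1).mpr (Real.summable_nat_rpow.mpr hq)
  simpa using this

lemma sum_bound (b : ℕ → ℂ) (C p r : ℝ) (hC : 0 ≤ C)
    (hb : ∀ m, ‖b m‖ ≤ C * ((m : ℝ) + 1) ^ p) (hr : 0 ≤ r) (hpr : p - r < -1) :
    ∃ C' : ℝ, 0 ≤ C' ∧ ∀ n : ℕ, ‖∑ m ∈ Finset.range n, b m‖ ≤ C' * ((n : ℝ) + 1) ^ r := by
  have hs := summable_shift hpr
  refine ⟨C * ∑' m : ℕ, ((m : ℝ) + 1) ^ (p - r),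
    mul_nonneg hC (tsum_nonneg (fun m => by positivity)), fun n => ?_⟩
  calc ‖∑ m ∈ Finset.range n, b m‖ ≤ ∑ m ∈ Finset.range n, ‖b m‖ := norm_sum_le _ _
    _ ≤ ∑ m ∈ Finset.range n, C * ((n : ℝ) + 1) ^ r * ((m : ℝ) + 1) ^ (p - r) := by
      refine Finset.sum_le_sum (fun m hm => (hb m).trans ?_)
      have hmn : (m : ℝ) ≤ n := by exact_mod_cast (Finset.mem_range.mp hm).le
      have e : ((m : ℝ) + 1) ^ p = ((m : ℝ) + 1) ^ r * ((m : ℝ) + 1) ^ (p - r) := by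
        rw [← Real.rpow_add (by positivity)]
        congr 1
        ring
      rw [e, mul_assoc]
      gcongr
    _ = C * ((n : ℝ) + 1) ^ r * ∑ m ∈ Finset.range n, ((m : ℝ) + 1) ^ (p - r) := by
      rw [Finset.mul_sum]
    _ ≤ C * ((n : ℝ) + 1) ^ r * ∑' m : ℕ, ((m : ℝ) + 1) ^ (p - r) := by
      gcongr
      exact hs.sum_le_tsum _ (fun m _ => by positivity)
    _ = _ := by ring

lemma half_norm (n : ℕ) : ((n : ℝ) + 1) / 2 ≤ ‖(n : ℂ) + 1/2‖ := by
  have e : (n : ℂ) + 1/2 = (((n : ℝ) + 1/2 : ℝ) : ℂ) := by push_cast; ring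
  rw [e, Complex.norm_real, Real.norm_of_nonneg (by positivity)]
  have : (0 : ℝ) ≤ n := by positivity
  linarith

lemma half_ne (n : ℕ) : (n : ℂ) + 1/2 ≠ 0 := by
  have := half_norm n
  intro h
  rw [h, norm_zero] at this
  have : (0 : ℝ) ≤ n := by positivity
  linarith

lemma uu_div_bound (x : ℂ) (h : HH x) :
    ∃ C : ℝ, 0 ≤ C ∧ ∀ n : ℕ, ‖uu x n / ((n : ℂ) + 1/2)‖ ≤ C * ((n : ℝ) + 1) ^ (2 * x.re - 2) := by
  obtain ⟨C, hC, hb⟩ := uu_bound x h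
  refine ⟨2 * C, by positivity, fun n => ?_⟩
  have h1 := half_norm n
  have hp : (0 : ℝ) < (n : ℝ) + 1 := by positivity
  rw [norm_div, div_le_iff₀ (by linarith)]
  have e : ((n : ℝ) + 1) ^ (2 * x.re - 1) = ((n : ℝ) + 1) ^ (2 * x.re - 2) * ((n : ℝ) + 1) := by
    rw [← Real.rpow_add_one hp.ne']
    congr 1
    ring
  calc ‖uu x n‖ ≤ C * ((n : ℝ) + 1) ^ (2 * x.re - 1) := hb n
    _ = 2 * C * ((n : ℝ) + 1) ^ (2 * x.re - 2) * (((n : ℝ) + 1) / 2) := by rw [e]; ring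
    _ ≤ _ := by gcongr

/-- The inner sum. -/
noncomputable def ff (x : ℂ) (n : ℕ) : ℂ :=
  uu x n / ((n : ℂ) + 1/2) * ∑ m ∈ Finset.range n, uu (-x) m / ((m : ℂ) + 1/2)

lemma Fgen_eq (x : ℂ) : Fgen x = ∑' n, ff x n := by
  unfold Fgen
  congr 1
  ext n
  unfold ff
  rw [Finset.mul_sum]
  refine Finset.sum_congr rfl (fun m _ => ?_)
  unfold uu
  rw [sub_neg_eq_add, ← sub_eq_add_neg]
  simp only [div_eq_mul_inv, mul_inv]
  ring

lemma ff_summable (x : ℂ) (h : HH x) (hre : x.re < 1/2) : Summable (ff x) := by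
  obtain ⟨C, hC, hb⟩ := uu_div_bound x h
  obtain ⟨D, hD, hd⟩ := uu_div_bound (-x) h.neg
  obtain ⟨r, hr0, hr1, hr2⟩ : ∃ r : ℝ, 0 ≤ r ∧ 2 * (-x).re - 2 - r < -1 ∧
      2 * x.re - 2 + r < -1 := by
    refine ⟨max 0 (-2 * x.re), le_max_left _ _, ?_, ?_⟩
    · have := le_max_right 0 (-2 * x.re)
      simp only [Complex.neg_re]
      linarith
    · rcases max_cases 0 (-2 * x.re) with h | h <;> linarith [h.1]
  obtain ⟨E, hE, he⟩ := sum_bound _ D _ r hD hd hr0 hr1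
  refine Summable.of_norm_bounded ((summable_shift hr2).mul_left (C * E)) (fun n => ?_)
  unfold ff
  rw [norm_mul, Real.rpow_add (by positivity)]
  calc _ ≤ (C * ((n : ℝ) + 1) ^ (2 * x.re - 2)) * (E * ((n : ℝ) + 1) ^ r) :=
        mul_le_mul (hb n) (he n) (norm_nonneg _) (by positivity)
    _ = _ := by ring

lemma ff_tendsto (x : ℂ) (h : HH x) (hre : x.re < 1/2) :
    Tendsto (fun K => ∑ n ∈ Finset.range K, ff x n) atTop (𝓝 (Fgen x)) := by
  rw [Fgen_eq]
  exact (ff_summable x h hre).hasSum.tendsto_sum_nat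

lemma lin_ne {x : ℂ} (h : HH x) (n : ℕ) (k : ℤ) : (n : ℂ) + 1/2 + x + k ≠ 0 := by
  have := h.ne (n + k)
  push_cast at this
  intro h'
  apply this
  linear_combination h'

lemma lin_ne' {x : ℂ} (h : HH x) (n : ℕ) (k : ℤ) : (n : ℂ) + 1/2 - x + k ≠ 0 := by
  have := lin_ne h.neg n k
  rwa [← sub_eq_add_neg] at this

lemma Gam_ne {x : ℂ} (h : HH x) (n : ℕ) (k : ℤ) : Complex.Gamma ((n : ℂ) + 1/2 + x + k) ≠ 0 := by
  refine Complex.Gamma_ne_zero (fun m hm => ?_)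
  apply lin_ne h n (k + m)
  push_cast
  linear_combination hm

lemma Gam_rec {x : ℂ} (h : HH x) (n : ℕ) (k : ℤ) :
    Complex.Gamma ((n : ℂ) + 1/2 + x + k + 1)
      = ((n : ℂ) + 1/2 + x + k) * Complex.Gamma ((n : ℂ) + 1/2 + x + k) :=
  Complex.Gamma_add_one _ (lin_ne h n k)

lemma uu_eq (x : ℂ) (n : ℕ) :
    uu x n = Complex.Gamma ((n : ℂ) + 1/2 + x + (0 : ℤ)) /
      Complex.Gamma ((n : ℂ) + 1/2 + -x + (1 : ℤ)) := by
  unfold uu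
  congr 2 <;> push_cast <;> ring

lemma uu_succ {x : ℂ} (h : HH x) (n : ℕ) :
    ((n : ℂ) + 3/2 - x) * uu x (n + 1) = ((n : ℂ) + 1/2 + x) * uu x n := by
  have h1 := Gam_rec h n 0
  have h2 := Gam_rec h.neg n 1
  have g1 := Gam_ne h.neg n 1
  have l1 := lin_ne h.neg n 1
  have e : uu x (n + 1) = Complex.Gamma ((n : ℂ) + 1/2 + x + (0 : ℤ) + 1) /
      Complex.Gamma ((n : ℂ) + 1/2 + -x + (1 : ℤ) + 1) := by
    unfold uu
    congr 2 <;> push_cast <;> ring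
  rw [e, uu_eq, h1, h2]
  have q1 : (n : ℂ) + 3/2 - x = (n : ℂ) + 1/2 + -x + (1 : ℤ) := by push_cast; ring
  have q2 : (n : ℂ) + 1/2 + x = (n : ℂ) + 1/2 + x + (0 : ℤ) := by push_cast; ring
  rw [q1]
  nth_rewrite 3 [q2]
  generalize Complex.Gamma ((n : ℂ) + 1/2 + -x + (1 : ℤ)) = G at *
  generalize (n : ℂ) + 1/2 + -x + (1 : ℤ) = L at *
  field_simp

lemma uu_add_one {x : ℂ} (h : HH x) (n : ℕ) :
    uu (x + 1) n = (((n : ℂ) + 1/2) ^ 2 - x ^ 2) * uu x n := by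
  have h1 := Gam_rec h n 0
  have h2 := Gam_rec h.neg n 0
  have g1 := Gam_ne h.neg n 0
  have l1 := lin_ne h.neg n 0
  have e : uu (x + 1) n = Complex.Gamma ((n : ℂ) + 1/2 + x + (0 : ℤ) + 1) /
      Complex.Gamma ((n : ℂ) + 1/2 + -x + (0 : ℤ)) := by
    unfold uu
    congr 2 <;> push_cast <;> ring
  have e2 : uu x n = Complex.Gamma ((n : ℂ) + 1/2 + x + (0 : ℤ)) /
      Complex.Gamma ((n : ℂ) + 1/2 + -x + (0 : ℤ) + 1) := by
    unfold uu
    congr 2 <;> push_cast <;> ring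
  rw [e, e2, h1, h2]
  have q1 : ((n : ℂ) + 1/2) ^ 2 - x ^ 2 = ((n : ℂ) + 1/2 + -x + (0 : ℤ)) *
      ((n : ℂ) + 1/2 + x + (0 : ℤ)) := by push_cast; ring
  rw [q1]
  generalize Complex.Gamma ((n : ℂ) + 1/2 + -x + (0 : ℤ)) = G at *
  generalize (n : ℂ) + 1/2 + -x + (0 : ℤ) = L at *
  field_simp

lemma uu_neg {x : ℂ} (h : HH x) (n : ℕ) :
    uu (-x) n * uu x n * (((n : ℂ) + 1/2) ^ 2 - x ^ 2) = 1 := by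
  have h1 := Gam_rec h n 0
  have h2 := Gam_rec h.neg n 0
  have g1 := Gam_ne h n 0
  have g2 := Gam_ne h.neg n 0
  have l1 := lin_ne h n 0
  have l2 := lin_ne h.neg n 0
  have e : uu (-x) n = Complex.Gamma ((n : ℂ) + 1/2 + -x + (0 : ℤ)) /
      Complex.Gamma ((n : ℂ) + 1/2 + x + (0 : ℤ) + 1) := by
    unfold uu
    congr 2 <;> push_cast <;> ring
  have e2 : uu x n = Complex.Gamma ((n : ℂ) + 1/2 + x + (0 : ℤ)) /
      Complex.Gamma ((n : ℂ) + 1/2 + -x + (0 : ℤ) + 1) := by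
    unfold uu
    congr 2 <;> push_cast <;> ring
  rw [e, e2, h1, h2]
  have q1 : ((n : ℂ) + 1/2) ^ 2 - x ^ 2 = ((n : ℂ) + 1/2 + -x + (0 : ℤ)) *
      ((n : ℂ) + 1/2 + x + (0 : ℤ)) := by push_cast; ring
  rw [q1]
  generalize Complex.Gamma ((n : ℂ) + 1/2 + -x + (0 : ℤ)) = G at *
  generalize Complex.Gamma ((n : ℂ) + 1/2 + x + (0 : ℤ)) = G' at *
  generalize (n : ℂ) + 1/2 + -x + (0 : ℤ) = L at *
  generalize (n : ℂ) + 1/2 + x + (0 : ℤ) = L' at *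
  field_simp

/-- Rational summand. -/
noncomputable def gg (x : ℂ) (n : ℕ) : ℂ :=
  -(x + 1) ^ 2 * ((n : ℂ) + 1) / (((n : ℂ) + 1/2) * ((n : ℂ) + 1/2 + x + 1) *
      ((n : ℂ) + 1/2 - x) * ((n : ℂ) + 1/2 - x - 1))
  + x ^ 2 * n / (((n : ℂ) + 1/2) * ((n : ℂ) + 1/2 + x) *
      ((n : ℂ) + 1/2 - x) * ((n : ℂ) + 1/2 - x - 1))

lemma uv {x : ℂ} (h : HH x) (n : ℕ) : uu x n * uu (-(x + 1)) n
    = 1 / (((n : ℂ) + 1/2 + x) * ((n : ℂ) + 1/2 + x + 1) *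
      ((n : ℂ) + 1/2 - x) * ((n : ℂ) + 1/2 - x - 1)) := by
  have h1 := uu_neg h n
  have h2 := uu_add_one h.add_one.neg n
  rw [show -(x + 1) + 1 = -x by ring] at h2
  rw [h2] at h1
  have a1 := lin_ne h n 0
  have a2 := lin_ne h n 1
  have a3 := lin_ne' h n 0
  have a4 := lin_ne' h n (-1)
  push_cast at a1 a2 a3 a4
  simp only [add_zero, ← sub_eq_add_neg] at a1 a2 a3 a4
  rw [eq_div_iff (mul_ne_zero (mul_ne_zero (mul_ne_zero a1 a2) a3) a4)]
  linear_combination h1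

/-- Remainder. -/
noncomputable def rr (x : ℂ) (K : ℕ) : ℂ :=
  (x + 1) ^ 2 * ((K : ℂ) * ((K : ℂ) + 1/2 - x) * uu x K) *
    ∑ m ∈ Finset.range K, uu (-(x + 1)) m / ((m : ℂ) + 1/2)

lemma mv_sum {x : ℂ} (h : HH x) (n : ℕ) :
    (2 * x + 1) * ∑ m ∈ Finset.range n, ((m : ℂ) + 1/2) * uu (-(x + 1)) m
      = -((n : ℂ) * ((n : ℂ) + 1/2 + x + 1) * uu (-(x + 1)) n) := by
  induction n with
  | zero => simp
  | succ n ih =>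
    rw [Finset.sum_range_succ, mul_add, ih]
    have := uu_succ h.add_one.neg n
    push_cast
    linear_combination (n + 1 : ℂ) * this

lemma ff_diff {x : ℂ} (h : HH x) (n : ℕ) :
    (x + 1) ^ 2 * ff (x + 1) n - x ^ 2 * ff x n =
      (x + 1) ^ 2 * (((n : ℂ) + 1/2) * uu x n) *
        ∑ m ∈ Finset.range n, uu (-(x + 1)) m / ((m : ℂ) + 1/2)
      - x ^ 2 * (uu x n / ((n : ℂ) + 1/2)) *
        ∑ m ∈ Finset.range n, ((m : ℂ) + 1/2) * uu (-(x + 1)) m := by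
  unfold ff
  have h2 : ∀ m, uu (-x) m / ((m : ℂ) + 1/2) = ((m : ℂ) + 1/2) * uu (-(x + 1)) m
      - (x + 1) ^ 2 * (uu (-(x + 1)) m / ((m : ℂ) + 1/2)) := by
    intro m
    have h2 := uu_add_one h.add_one.neg m
    rw [show -(x + 1) + 1 = -x by ring] at h2
    rw [h2]
    have := half_ne m
    generalize (m : ℂ) + 1/2 = M at *
    field_simp
  simp_rw [h2]
  rw [Finset.sum_sub_distrib, ← Finset.mul_sum, uu_add_one h]
  have := half_ne n
  generalize (n : ℂ) + 1/2 = N at *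
  field_simp
  ring

lemma finite_id {x : ℂ} (h : HH x) (K : ℕ) :
    (2 * x + 1) * ((x + 1) ^ 2 * ∑ n ∈ Finset.range K, ff (x + 1) n
      - x ^ 2 * ∑ n ∈ Finset.range K, ff x n)
    = rr x K + ∑ n ∈ Finset.range K, gg x n := by
  induction K with
  | zero => simp [rr]
  | succ n ih =>
    rw [Finset.sum_range_succ, Finset.sum_range_succ, Finset.sum_range_succ (gg x)]
    have hd := ff_diff h n
    have hm := mv_sum h n
    have hu := uu_succ h n
    have huv := uv h n
    have hg : gg x n = -(x + 1) ^ 2 * ((n : ℂ) + 1) * ((n : ℂ) + 1/2 + x) *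
        (uu x n * uu (-(x + 1)) n) / ((n : ℂ) + 1/2) + x ^ 2 * n * ((n : ℂ) + 1/2 + x + 1) *
        (uu x n * uu (-(x + 1)) n) / ((n : ℂ) + 1/2) := by
      rw [huv]
      unfold gg
      have a1 := lin_ne h n 0
      have a2 := lin_ne h n 1
      have a3 := lin_ne' h n 0
      have a4 := lin_ne' h n (-1)
      have a5 := half_ne n
      push_cast at a1 a2 a3 a4
      simp only [add_zero, ← sub_eq_add_neg] at a1 a2 a3 a4
      generalize (n : ℂ) + 1/2 = N at *
      congr 1 <;> field_simp
    have hr : rr x (n + 1) = (x + 1) ^ 2 * (((n : ℂ) + 1) * (((n : ℂ) + 1/2 + x) * uu x n)) *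
        (∑ m ∈ Finset.range n, uu (-(x + 1)) m / ((m : ℂ) + 1/2)
          + uu (-(x + 1)) n / ((n : ℂ) + 1/2)) := by
      unfold rr
      rw [Finset.sum_range_succ, ← hu]
      push_cast
      ring
    rw [hr, hg]
    unfold rr at ih
    set B := ∑ m ∈ Finset.range n, uu (-(x + 1)) m / ((m : ℂ) + 1/2)
    set S := ∑ m ∈ Finset.range n, ((m : ℂ) + 1/2) * uu (-(x + 1)) m
    linear_combination ih + (2 * x + 1) * hd - x ^ 2 * (uu x n / ((n : ℂ) + 1/2)) * hm

lemma rr_tendsto {x : ℂ} (h : HH x) (hre : x.re < -(1/2)) :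
    Tendsto (rr x) atTop (𝓝 0) := by
  obtain ⟨C, hC, hb⟩ := uu_bound x h
  obtain ⟨D, hD, hd⟩ := uu_div_bound (-(x + 1)) h.add_one.neg
  obtain ⟨r, hr0, hr1, hr2⟩ : ∃ r : ℝ, 0 ≤ r ∧ 2 * (-(x + 1)).re - 2 - r < -1 ∧
      2 * x.re + 1 + r < 0 := by
    refine ⟨max 0 (-2 * x.re - 2), le_max_left _ _, ?_, ?_⟩
    · have := le_max_right 0 (-2 * x.re - 2)
      simp only [Complex.neg_re, Complex.add_re, Complex.one_re]
      linarith
    · rcases max_cases 0 (-2 * x.re - 2) with h | h <;> linarith [h.1]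
  obtain ⟨E, hE, he⟩ := sum_bound _ D _ r hD hd hr0 hr1
  have hlim : Tendsto (fun n : ℕ => (‖(x + 1) ^ 2‖ * (1 + ‖x‖) * C * E) *
      ((n : ℝ) + 1) ^ (2 * x.re + 1 + r)) atTop (𝓝 0) := by
    rw [← mul_zero (‖(x + 1) ^ 2‖ * (1 + ‖x‖) * C * E)]
    refine Tendsto.const_mul _ ?_
    have h1 := tendsto_rpow_neg_atTop (y := -(2 * x.re + 1 + r)) (by linarith)
    rw [neg_neg] at h1
    exact h1.comp (tendsto_atTop_add_const_right _ 1 tendsto_natCast_atTop_atTop)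
  refine squeeze_zero_norm (fun n => ?_) hlim
  have hp : (0 : ℝ) < (n : ℝ) + 1 := by positivity
  have hn0 : (0 : ℝ) ≤ n := by positivity
  have hl : ‖(n : ℂ) + 1/2 - x‖ ≤ (1 + ‖x‖) * ((n : ℝ) + 1) := by
    have e : (n : ℂ) + 1/2 = (((n : ℝ) + 1/2 : ℝ) : ℂ) := by push_cast; ring
    calc _ ≤ ‖(n : ℂ) + 1/2‖ + ‖x‖ := norm_sub_le _ _
      _ = (n : ℝ) + 1/2 + ‖x‖ := by
        rw [e, Complex.norm_real, Real.norm_of_nonneg (by positivity)]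
      _ ≤ _ := by nlinarith [norm_nonneg x]
  have e : ((n : ℝ) + 1) ^ (2 * x.re + 1 + r) = ((n : ℝ) + 1) * ((n : ℝ) + 1) *
      ((n : ℝ) + 1) ^ (2 * x.re - 1) * ((n : ℝ) + 1) ^ r := by
    rw [Real.rpow_add hp, show 2 * x.re + 1 = 2 * x.re - 1 + 1 + 1 by ring,
      Real.rpow_add_one hp.ne', Real.rpow_add_one hp.ne']
    ring
  unfold rr
  rw [norm_mul, norm_mul, norm_mul, norm_mul, Complex.norm_natCast, e]
  calc _ ≤ ‖(x + 1) ^ 2‖ * (((n : ℝ) + 1) * ((1 + ‖x‖) * ((n : ℝ) + 1)) *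
        (C * ((n : ℝ) + 1) ^ (2 * x.re - 1))) * (E * ((n : ℝ) + 1) ^ r) := by
        gcongr
        · linarith
        · exact hb n
        · exact he n
    _ = _ := by ring

/-- Telescoper. -/
noncomputable def tt (x M : ℂ) : ℂ :=
  x / (4 * (2 * x + 1)) / (M + x) - (x + 2) / (4 * (2 * x + 3)) / (M + x + 1)
  - (5 * x + 2) / (4 * (2 * x + 1)) / (M - x - 1) + (5 * x + 8) / (4 * (2 * x + 3)) / (M - x - 2)

lemma tele_alg (x M : ℂ) (h1 : 2 * x + 1 ≠ 0) (h2 : 2 * x + 3 ≠ 0) (hM : M ≠ 0)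
    (a1 : M + x ≠ 0) (a2 : M + x + 1 ≠ 0) (a3 : M + x + 2 ≠ 0)
    (b0 : M - x ≠ 0) (b1 : M - x - 1 ≠ 0) (b2 : M - x - 2 ≠ 0) :
    (x + 2) / (2 * x + 3) * (-(x + 2) ^ 2 * (M + 1/2) / (M * (M + x + 2) * (M - x - 1) * (M - x - 2))
      + (x + 1) ^ 2 * (M - 1/2) / (M * (M + x + 1) * (M - x - 1) * (M - x - 2)))
    - x / (2 * x + 1) * (-(x + 1) ^ 2 * (M + 1/2) / (M * (M + x + 1) * (M - x) * (M - x - 1))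
      + x ^ 2 * (M - 1/2) / (M * (M + x) * (M - x) * (M - x - 1)))
    = (x / (4 * (2 * x + 1)) / (M + x + 1) - (x + 2) / (4 * (2 * x + 3)) / (M + x + 2)
  - (5 * x + 2) / (4 * (2 * x + 1)) / (M - x) + (5 * x + 8) / (4 * (2 * x + 3)) / (M - x - 1))
    - tt x M := by
  unfold tt
  obtain ⟨P, rfl⟩ : ∃ P : ℂ, x = (P - 1) / 2 := ⟨2 * x + 1, by ring⟩
  obtain ⟨Q, rfl⟩ : ∃ Q : ℂ, M = Q / 2 := ⟨2 * M, by ring⟩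
  rw [show 2 * ((P - 1) / 2) + 1 = P by ring] at *
  rw [show 2 * ((P - 1) / 2) + 3 = P + 2 by ring] at *
  rw [show Q / 2 + (P - 1) / 2 = (Q + P - 1) / 2 by ring] at *
  rw [show (Q + P - 1) / 2 + 1 = (Q + P + 1) / 2 by ring] at *
  rw [show (Q + P - 1) / 2 + 2 = (Q + P + 3) / 2 by ring] at *
  rw [show Q / 2 - (P - 1) / 2 = (Q - P + 1) / 2 by ring] at *
  rw [show (Q - P + 1) / 2 - 1 = (Q - P - 1) / 2 by ring] at *
  rw [show (Q - P + 1) / 2 - 2 = (Q - P - 3) / 2 by ring] at *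
  replace hM : Q ≠ 0 := fun h => hM (by rw [h]; ring)
  replace a1 : Q + P - 1 ≠ 0 := fun h => a1 (by rw [h]; ring)
  replace a2 : Q + P + 1 ≠ 0 := fun h => a2 (by rw [h]; ring)
  replace a3 : Q + P + 3 ≠ 0 := fun h => a3 (by rw [h]; ring)
  replace b0 : Q - P + 1 ≠ 0 := fun h => b0 (by rw [h]; ring)
  replace b1 : Q - P - 1 ≠ 0 := fun h => b1 (by rw [h]; ring)
  replace b2 : Q - P - 3 ≠ 0 := fun h => b2 (by rw [h]; ring)
  field_simp
  ring

lemma tele {x : ℂ} (h : HH x) (n : ℕ) (h1 : 2 * x + 1 ≠ 0) (h2 : 2 * x + 3 ≠ 0) :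
    (x + 2) / (2 * x + 3) * gg (x + 1) n - x / (2 * x + 1) * gg x n
      = tt x (((n + 1 : ℕ) : ℂ) + 1/2) - tt x ((n : ℂ) + 1/2) := by
  have a1 := lin_ne h n 0
  have a2 := lin_ne h n 1
  have a3 := lin_ne h n 2
  have b0 := lin_ne' h n 0
  have b1 := lin_ne' h n (-1)
  have b2 := lin_ne' h n (-2)
  push_cast at a1 a2 a3 b0 b1 b2
  simp only [add_zero, ← sub_eq_add_neg] at a1 a2 a3 b0 b1 b2
  have := tele_alg x ((n : ℂ) + 1/2) h1 h2 (half_ne n) a1 a2 a3 b0 b1 b2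
  have e1 : gg (x + 1) n = (-(x + 2) ^ 2 * (((n : ℂ) + 1/2) + 1/2) / (((n : ℂ) + 1/2) * (((n : ℂ) + 1/2) + x + 2) * (((n : ℂ) + 1/2) - x - 1) * (((n : ℂ) + 1/2) - x - 2))
      + (x + 1) ^ 2 * (((n : ℂ) + 1/2) - 1/2) / (((n : ℂ) + 1/2) * (((n : ℂ) + 1/2) + x + 1) * (((n : ℂ) + 1/2) - x - 1) * (((n : ℂ) + 1/2) - x - 2))) := by
    unfold gg
    congr 2 <;> ring
  have e2 : gg x n = (-(x + 1) ^ 2 * (((n : ℂ) + 1/2) + 1/2) / (((n : ℂ) + 1/2) * (((n : ℂ) + 1/2) + x + 1) * (((n : ℂ) + 1/2) - x) * (((n : ℂ) + 1/2) - x - 1))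
      + x ^ 2 * (((n : ℂ) + 1/2) - 1/2) / (((n : ℂ) + 1/2) * (((n : ℂ) + 1/2) + x) * (((n : ℂ) + 1/2) - x) * (((n : ℂ) + 1/2) - x - 1))) := by
    unfold gg
    congr 2 <;> ring
  rw [e1, e2, this]
  congr 1
  unfold tt
  push_cast
  congr 2
  · congr 2 <;> ring
  · ring
  · ring

lemma tt_tendsto (x : ℂ) : Tendsto (fun n : ℕ => tt x ((n : ℂ) + 1/2)) atTop (𝓝 0) := by
  have key : ∀ c d : ℂ, Tendsto (fun n : ℕ => c / ((n : ℂ) + d)) atTop (𝓝 0) := by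
    intro c d
    have h1 : Tendsto (fun n : ℕ => ((n : ℂ) + d)) atTop (Bornology.cobounded ℂ) := by
      rw [← tendsto_norm_atTop_iff_cobounded]
      refine tendsto_atTop_mono (f := fun n : ℕ => (n : ℝ) - ‖d‖) (fun n => ?_) ?_
      · have := norm_sub_le ((n : ℂ) + d) d
        simp at this
        linarith
      · exact tendsto_atTop_add_const_right _ _ tendsto_natCast_atTop_atTop
    have := (tendsto_inv₀_cobounded.comp h1).const_mul c
    simpa [div_eq_mul_inv] using this
  have := (((key (x / (4 * (2 * x + 1))) (1/2 + x)).sub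
    (key ((x + 2) / (4 * (2 * x + 3))) (1/2 + x + 1))).sub
    (key ((5 * x + 2) / (4 * (2 * x + 1))) (1/2 - x - 1))).add
    (key ((5 * x + 8) / (4 * (2 * x + 3))) (1/2 - x - 2))
  simp only [sub_zero, add_zero] at this
  refine this.congr (fun n => ?_)
  unfold tt
  congr 2
  · congr 2 <;> ring
  · ring
  · ring

theorem Fgen_recurrence (x : ℂ) (hre : x.re < -(3/2))
    (hx : ¬∃ k : ℤ, x = (k : ℂ) + 1/2) :
    x ^ 3 * Fgen x - 2 * (x + 1) ^ 3 * Fgen (x + 1) + (x + 2) ^ 3 * Fgen (x + 2)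
      + 4 * (2 * x ^ 2 + 4 * x + 1) / ((2 * x + 1) ^ 2 * (2 * x + 3) ^ 2) = 0 := by
  have h : HH x := fun k hk => hx ⟨k, hk⟩
  have h1 : 2 * x + 1 ≠ 0 := by
    intro h'
    apply h (-1)
    push_cast
    linear_combination h' / 2
  have h2 : 2 * x + 3 ≠ 0 := by
    intro h'
    apply h (-2)
    push_cast
    linear_combination h' / 2
  have hF0 := ff_tendsto x h (by linarith)
  have hF1 := ff_tendsto (x + 1) h.add_one (by simp; linarith)
  have hF2 := ff_tendsto (x + 1 + 1) h.add_one.add_one (by simp; linarith)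
  have hr0 := rr_tendsto h (by linarith)
  have hr1 := rr_tendsto h.add_one (by simp; linarith)
  have ht := tt_tendsto x
  have lim1 := ((hF0.const_mul (x ^ 3)).sub (hF1.const_mul (2 * (x + 1) ^ 3))).add
    (hF2.const_mul ((x + 2) ^ 3))
  have lim2 := ((hr1.const_mul ((x + 2) / (2 * x + 3))).sub
    (hr0.const_mul (x / (2 * x + 1)))).add (ht.sub_const (tt x (((0 : ℕ) : ℂ) + 1/2)))
  have heq := tendsto_nhds_unique lim1 (lim2.congr (fun K => ?_))
  · rw [show x + 1 + 1 = x + 2 by ring] at heq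
    rw [heq]
    unfold tt
    have e1 : (((0 : ℕ) : ℂ) + 1/2 + x) = (2 * x + 1) / 2 := by push_cast; ring
    have e2 : (((0 : ℕ) : ℂ) + 1/2 + x + 1) = (2 * x + 3) / 2 := by push_cast; ring
    have e3 : (((0 : ℕ) : ℂ) + 1/2 - x - 1) = -(2 * x + 1) / 2 := by push_cast; ring
    have e4 : (((0 : ℕ) : ℂ) + 1/2 - x - 2) = -(2 * x + 3) / 2 := by push_cast; ring
    rw [e2, e1, e3, e4]
    have h1' : x * 2 + 1 ≠ 0 := by rwa [mul_comm]
    have h2' : x * 2 + 3 ≠ 0 := by rwa [mul_comm]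
    field_simp
    ring
  · have f0 := finite_id h K
    have f1 := finite_id h.add_one K
    have hs : ∑ n ∈ Finset.range K, ((x + 2) / (2 * x + 3) * gg (x + 1) n
        - x / (2 * x + 1) * gg x n) = tt x ((K : ℂ) + 1/2) - tt x (((0 : ℕ) : ℂ) + 1/2) := by
      rw [← Finset.sum_range_sub (fun n : ℕ => tt x ((n : ℂ) + 1/2))]
      exact Finset.sum_congr rfl (fun n _ => tele h n h1 h2)
    rw [Finset.sum_sub_distrib, ← Finset.mul_sum, ← Finset.mul_sum] at hs
    have q1 : (x + 2) / (2 * x + 3) * (2 * (x + 1) + 1) = x + 2 := by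
      rw [show 2 * (x + 1) + 1 = 2 * x + 3 by ring]
      exact div_mul_cancel₀ _ h2
    have q0 : x / (2 * x + 1) * (2 * x + 1) = x := div_mul_cancel₀ _ h1
    rw [← hs]
    generalize (x + 2) / (2 * x + 3) = β at *
    generalize x / (2 * x + 1) = α at *
    set S0 := ∑ n ∈ Finset.range K, ff x n
    set S1 := ∑ n ∈ Finset.range K, ff (x + 1) n
    set S2 := ∑ n ∈ Finset.range K, ff (x + 1 + 1) n
    linear_combination (-β) * f1 + α * f0 + ((x + 1 + 1) ^ 2 * S2 - (x + 1) ^ 2 * S1) * q1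
      - ((x + 1) ^ 2 * S1 - x ^ 2 * S0) * q0
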